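/- For a positive integer n, let B(n) be the set of positive integers b ≤ n that can be written as b = u·v·w with positive integers u, v, w each lying in the interval [n^{1/3}/(log n)^{16}, n^{1/3}·(log n)^{16}]. Then for every ε > 0 there exists n_0(ε) such that for every integer n ≥ n_0(ε), |B(n)| ≤ n/(log n)^{1 − (e·log 3)/(2√3) − ε}. -/

import Mathlib

open Finset Filter

noncomputable def hh (m : ℕ) : ℝ := (1/2 : ℝ) ^ (ArithmeticFunction.cardFactors m)

lemma hh_pos (m : ℕ) : 0 < hh m := by unfold hh; positivity
lemma hh_le_one (m : ℕ) : hh m ≤ 1 := by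
  unfold hh; exact pow_le_one₀ (by norm_num) (by norm_num)
lemma hh_mul {a b : ℕ} (ha : a ≠ 0) (hb : b ≠ 0) : hh (a * b) = hh a * hh b := by
  unfold hh; rw [ArithmeticFunction.cardFactors_mul ha hb, pow_add]

lemma card_div_le (k : ℕ) (hk : k ≠ 0) :
    k.divisors.card ≤ 2 ^ (ArithmeticFunction.cardFactors k) := by
  induction k using Nat.recOnMul with
  | zero => exact absurd rfl hk
  | one => simp
  | prime p hp => rw [ArithmeticFunction.cardFactors_apply_prime hp, Nat.Prime.divisors hp]; exact Finset.card_le_two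
  | mul a b iha ihb =>
    have ha : a ≠ 0 := by rintro rfl; simp at hk
    have hb : b ≠ 0 := by rintro rfl; simp at hk
    rw [ArithmeticFunction.cardFactors_mul ha hb, pow_add, Nat.divisors_mul]
    exact Finset.card_mul_le.trans (Nat.mul_le_mul (iha ha) (ihb hb))

lemma two_pow_le (k : ℕ) (hk : k ≠ 0) : 2 ^ (ArithmeticFunction.cardFactors k) ≤ k := by
  induction k using Nat.recOnMul with
  | zero => exact absurd rfl hk
  | one => simp
  | prime p hp => rw [ArithmeticFunction.cardFactors_apply_prime hp]; simpa using hp.two_le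
  | mul a b iha ihb =>
    have ha : a ≠ 0 := by rintro rfl; simp at hk
    have hb : b ≠ 0 := by rintro rfl; simp at hk
    rw [ArithmeticFunction.cardFactors_mul ha hb, pow_add]
    exact (Nat.mul_le_mul (iha ha) (ihb hb))

lemma sqf_le (k : ℕ) (hk : Squarefree k) :
    2 ^ (ArithmeticFunction.cardFactors k) = k.divisors.card := by
  rw [Nat.card_divisors hk.ne_zero]
  rw [← (ArithmeticFunction.cardDistinctFactors_eq_cardFactors_iff_squarefree hk.ne_zero).2 hk,
    ArithmeticFunction.cardDistinctFactors_apply, ← List.card_toFinset]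
  rw [← Finset.prod_const]
  refine Finset.prod_congr rfl fun p hp => ?_
  have hp' : p.Prime := Nat.prime_of_mem_primeFactors hp
  have := (hk.natFactorization_le_one p)
  have h2 := hp'.factorization_pos_of_dvd hk.ne_zero (Nat.dvd_of_mem_primeFactors hp)
  omega

lemma harm_le (N : ℕ) : ∑ k ∈ Ioc 0 N, (k : ℝ)⁻¹ ≤ 1 + Real.log N := by
  have := harmonic_le_one_add_log N
  rw [harmonic_eq_sum_Icc] at this
  push_cast at this
  exact this

lemma L1 (N : ℕ) : (∑ m ∈ Ioc 0 N, hh m / m) ^ 2 ≤ 1 + 2 * Real.log N := by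
  have h1 : (∑ m ∈ Ioc 0 N, hh m / m) ^ 2 =
      ∑ x ∈ Ioc 0 N ×ˢ Ioc 0 N, hh (x.1 * x.2) / ((x.1 * x.2 : ℕ) : ℝ) := by
    rw [sq, Finset.sum_mul_sum, Finset.sum_product]
    refine Finset.sum_congr rfl fun a ha => Finset.sum_congr rfl fun b hb => ?_
    simp only [mem_Ioc] at ha hb
    rw [hh_mul (by omega) (by omega)]
    push_cast
    rw [div_mul_div_comm]
  have h2 : ∀ x ∈ Ioc 0 N ×ˢ Ioc 0 N, x.1 * x.2 ∈ Ioc 0 (N^2) := by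
    intro x hx
    simp only [mem_product, mem_Ioc] at hx ⊢
    exact ⟨Nat.mul_pos hx.1.1 hx.2.1, by rw [sq]; exact Nat.mul_le_mul hx.1.2 hx.2.2⟩
  rw [h1, ← Finset.sum_fiberwise_of_maps_to h2]
  have h3 : ∀ k ∈ Ioc 0 (N^2), ∑ x ∈ Ioc 0 N ×ˢ Ioc 0 N with x.1 * x.2 = k,
      hh (x.1 * x.2) / ((x.1 * x.2 : ℕ) : ℝ) ≤ (k : ℝ)⁻¹ := by
    intro k hk
    simp only [mem_Ioc] at hk
    have : ∑ x ∈ Ioc 0 N ×ˢ Ioc 0 N with x.1 * x.2 = k,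
      hh (x.1 * x.2) / ((x.1 * x.2 : ℕ) : ℝ) = ∑ x ∈ Ioc 0 N ×ˢ Ioc 0 N with x.1 * x.2 = k, hh k / k := by
      refine Finset.sum_congr rfl fun x hx => ?_
      rw [(Finset.mem_filter.1 hx).2]
    rw [this, Finset.sum_const, nsmul_eq_mul]
    have hc : ((Ioc 0 N ×ˢ Ioc 0 N).filter fun x => x.1 * x.2 = k).card ≤ 2 ^ (ArithmeticFunction.cardFactors k) := by
      refine le_trans ?_ (card_div_le k (by omega))
      apply Finset.card_le_card_of_injOn Prod.fst
      · intro x hx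
        simp only [coe_filter, Set.mem_ofPred_eq] at hx
        rw [Finset.mem_coe, Nat.mem_divisors]
        exact ⟨⟨x.2, hx.2.symm⟩, by omega⟩
      · intro x hx y hy hxy
        simp only [coe_filter, Set.mem_ofPred_eq, mem_product, mem_Ioc] at hx hy
        refine Prod.ext hxy ?_
        have h := hx.2.trans hy.2.symm
        rw [hxy] at h
        exact Nat.eq_of_mul_eq_mul_left hy.1.1.1 h
    have hc' : (((Ioc 0 N ×ˢ Ioc 0 N).filter fun x => x.1 * x.2 = k).card : ℝ) ≤ 2 ^ (ArithmeticFunction.cardFactors k) := by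
      exact_mod_cast hc
    calc _ ≤ (2:ℝ) ^ (ArithmeticFunction.cardFactors k) * (hh k / k) := by
          gcongr
          exact div_nonneg (hh_pos k).le (by positivity)
      _ = (k:ℝ)⁻¹ := by
          unfold hh
          rw [← mul_div_assoc, ← mul_pow]; norm_num
  refine (Finset.sum_le_sum h3).trans ((harm_le _).trans ?_)
  push_cast
  rw [Real.log_pow]; norm_num

noncomputable def HA : ArithmeticFunction ℝ := ⟨fun m => if m = 0 then 0 else hh m, by simp⟩
lemma HA_apply {m : ℕ} (hm : m ≠ 0) : HA m = hh m := by
  show (if m = 0 then 0 else hh m) = _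
  simp [hm]

lemma L2 (N : ℕ) : ∑ m ∈ Ioc 0 N, hh m * Real.log m ≤
    (Real.log 4 + 4) * N * ∑ m ∈ Ioc 0 N, hh m / m := by
  have h1 : ∀ m ∈ Ioc 0 N, hh m * Real.log m ≤ (HA * ArithmeticFunction.vonMangoldt) m := by
    intro m hm
    simp only [mem_Ioc] at hm
    rw [← ArithmeticFunction.vonMangoldt_sum, ArithmeticFunction.mul_apply, Finset.mul_sum,
      Nat.sum_divisorsAntidiagonal' (f := fun a b => HA a * ArithmeticFunction.vonMangoldt b)]
    refine Finset.sum_le_sum fun d hd => ?_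
    obtain ⟨⟨e, rfl⟩, hm0⟩ := Nat.mem_divisors.1 hd
    have hd0 : d ≠ 0 := by rintro rfl; simp at hm0
    have he0 : e ≠ 0 := by rintro rfl; simp at hm0
    rw [Nat.mul_div_cancel_left _ (Nat.pos_of_ne_zero hd0), HA_apply he0, hh_mul hd0 he0]
    have := hh_le_one d
    have := hh_pos e
    have : 0 ≤ ArithmeticFunction.vonMangoldt d := ArithmeticFunction.vonMangoldt_nonneg
    gcongr
    nlinarith
  refine (Finset.sum_le_sum h1).trans ?_
  rw [ArithmeticFunction.sum_Ioc_mul_eq_sum_sum, Finset.mul_sum]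
  refine Finset.sum_le_sum fun j hj => ?_
  simp only [mem_Ioc] at hj
  rw [HA_apply (by omega)]
  have h2 := Chebyshev.psi_le_const_mul_self (x := ((N / j : ℕ) : ℝ)) (by positivity)
  unfold Chebyshev.psi at h2
  rw [Nat.floor_natCast] at h2
  have h3 : ((N / j : ℕ) : ℝ) ≤ N / j := Nat.cast_div_le
  have h4 : 0 ≤ Real.log 4 := Real.log_nonneg (by norm_num)
  have := hh_pos j
  calc _ ≤ hh j * ((Real.log 4 + 4) * (N / j)) := by
        gcongr
        exact h2.trans (by gcongr)
    _ = _ := by ring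

lemma L3 (N : ℕ) (hN : 2 ≤ N) : ∑ m ∈ Ioc 0 N, hh m ≤ 16 * N / Real.sqrt (Real.log N) := by
  set G := ∑ m ∈ Ioc 0 N, hh m / m with hG
  have hN' : (2:ℝ) ≤ N := by exact_mod_cast hN
  have hl : 0.69 ≤ Real.log N := by
    have := Real.log_le_log (by norm_num) hN'
    have := Real.log_two_gt_d9
    linarith
  have h4 : Real.log 4 ≤ 2 := by
    rw [show (4:ℝ) = 2 ^ 2 by norm_num, Real.log_pow]
    have := Real.log_two_lt_d9
    push_cast; linarith
  have hG0 : 0 ≤ G := Finset.sum_nonneg fun m _ => div_nonneg (hh_pos m).le (by positivity)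
  have hG1 : G ≤ 2 * Real.sqrt (Real.log N) := by
    have := L1 N
    rw [← hG] at this
    apply (sq_le_sq₀ hG0 (by positivity)).1
    rw [mul_pow, Real.sq_sqrt (by linarith)]
    linarith
  have h5 : (∑ m ∈ Ioc 0 N, hh m) * Real.log N ≤ 7 * N * G := by
    have h6 := L2 N
    rw [← hG] at h6
    have h7 : ∑ m ∈ Ioc 0 N, hh m * Real.log (N / m) ≤ N * G := by
      rw [hG, Finset.mul_sum]
      refine Finset.sum_le_sum fun m hm => ?_
      simp only [mem_Ioc] at hm
      have hm0 : (0:ℝ) < m := by exact_mod_cast hm.1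
      have := Real.log_le_self (x := (N:ℝ)/m) (by positivity)
      have := hh_pos m
      calc _ ≤ hh m * (N / m) := by gcongr
        _ = _ := by ring
    have h8 : (∑ m ∈ Ioc 0 N, hh m) * Real.log N =
        ∑ m ∈ Ioc 0 N, hh m * Real.log m + ∑ m ∈ Ioc 0 N, hh m * Real.log (N / m) := by
      rw [Finset.sum_mul, ← Finset.sum_add_distrib]
      refine Finset.sum_congr rfl fun m hm => ?_
      simp only [mem_Ioc] at hm
      have hm0 : (m:ℝ) ≠ 0 := by exact_mod_cast hm.1.ne'
      rw [Real.log_div (by positivity) hm0]; ring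
    have : (Real.log 4 + 4) * N * G ≤ 6 * N * G := by gcongr; linarith
    linarith
  have hs : 0 < Real.sqrt (Real.log N) := Real.sqrt_pos.2 (by linarith)
  rw [le_div_iff₀ hs]
  have h9 : (∑ m ∈ Ioc 0 N, hh m) * Real.sqrt (Real.log N) * Real.sqrt (Real.log N) ≤ (16 * N) * Real.sqrt (Real.log N) := by
    rw [mul_assoc, Real.mul_self_sqrt (by linarith)]
    have : 7 * N * G ≤ 7 * N * (2 * Real.sqrt (Real.log N)) := by gcongr
    have : 0 ≤ N * Real.sqrt (Real.log N) := by positivity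
    linarith
  exact le_of_mul_le_mul_right h9 hs

lemma L4 (a b : ℕ) (ha : 2 ≤ a) : ∑ u ∈ Icc a b, hh u / u ≤
    ((Nat.log 2 b + 1 - Nat.log 2 a : ℕ) : ℝ) * (32 / Real.sqrt (Real.log a)) := by
  have hla : 0 < Real.log a := Real.log_pos (by exact_mod_cast (by omega : 1 < a))
  have h1 : ∀ u ∈ Icc a b, Nat.log 2 u ∈ Icc (Nat.log 2 a) (Nat.log 2 b) := by
    intro u hu
    simp only [mem_Icc] at hu ⊢
    exact ⟨Nat.log_mono_right hu.1, Nat.log_mono_right hu.2⟩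
  rw [← Finset.sum_fiberwise_of_maps_to h1]
  have h2 : ∀ i ∈ Icc (Nat.log 2 a) (Nat.log 2 b),
      ∑ u ∈ Icc a b with Nat.log 2 u = i, hh u / u ≤ 32 / Real.sqrt (Real.log a) := by
    intro i hi
    simp only [mem_Icc] at hi
    have hia : a ≤ 2 ^ (i+1) :=
      (Nat.lt_pow_succ_log_self (by norm_num) a).le.trans (Nat.pow_le_pow_right (by norm_num) (by omega))
    have h3 := L3 (2 ^ (i+1)) (by omega)
    have h4 : ∑ u ∈ Icc a b with Nat.log 2 u = i, hh u / u ≤ ∑ u ∈ Ioc 0 (2^(i+1)), hh u / 2 ^ i := by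
      calc _ ≤ ∑ u ∈ Icc a b with Nat.log 2 u = i, hh u / 2 ^ i := by
            refine Finset.sum_le_sum fun u hu => ?_
            simp only [mem_filter, mem_Icc] at hu
            have := hh_pos u
            have h5 : 2 ^ i ≤ u := by rw [← hu.2]; exact Nat.pow_log_le_self 2 (by omega)
            have h6 : (2:ℝ) ^ i ≤ u := by exact_mod_cast h5
            gcongr
        _ ≤ _ := by
            refine Finset.sum_le_sum_of_subset_of_nonneg ?_ fun u _ _ => div_nonneg (hh_pos u).le (by positivity)
            intro u hu
            simp only [mem_filter, mem_Icc] at hu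
            rw [mem_Ioc]
            refine ⟨by omega, ?_⟩
            rw [← hu.2]
            exact (Nat.lt_pow_succ_log_self (by norm_num) u).le
    rw [← Finset.sum_div] at h4
    refine h4.trans ?_
    rw [div_le_iff₀ (by positivity)]
    refine h3.trans ?_
    have h7 : Real.sqrt (Real.log a) ≤ Real.sqrt (Real.log ((2 ^ (i+1) : ℕ) : ℝ)) := by
      apply Real.sqrt_le_sqrt
      apply Real.log_le_log (by positivity)
      exact_mod_cast hia
    have h8 : 0 < Real.sqrt (Real.log a) := Real.sqrt_pos.2 hla
    calc _ ≤ 16 * ((2 ^ (i+1) : ℕ) : ℝ) / Real.sqrt (Real.log a) := by gcongr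
      _ = _ := by push_cast; ring
  refine (Finset.sum_le_sum h2).trans ?_
  rw [Finset.sum_const, Nat.card_Icc, nsmul_eq_mul]

lemma L5 (n a b : ℕ) (ha : 2 ≤ a) (K : ℝ) (hK : 0 ≤ K) (S : Finset ℕ)
    (hS : ∀ x ∈ S, x ≤ n ∧ (2:ℝ) ^ (ArithmeticFunction.cardFactors x) ≤ K ∧
      ∃ u ∈ Icc a b, ∃ v ∈ Icc a b, ∃ w ∈ Icc a b, x = u * v * w) :
    (S.card : ℝ) ≤ K * n * (16 / Real.sqrt (Real.log a)) * (∑ u ∈ Icc a b, hh u / u) ^ 2 := by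
  have hla : 0 < Real.log a := Real.log_pos (by exact_mod_cast (by omega : 1 < a))
  have hsa : 0 < Real.sqrt (Real.log a) := Real.sqrt_pos.2 hla
  set W := Icc a b with hW
  set T := (W ×ˢ W ×ˢ W).filter (fun t => t.1 * t.2.1 * t.2.2 ≤ n ∧
    (2:ℝ) ^ (ArithmeticFunction.cardFactors (t.1 * t.2.1 * t.2.2)) ≤ K) with hT
  have h1 : S.card ≤ T.card := by
    apply Finset.card_le_card_of_surjOn (fun t => t.1 * t.2.1 * t.2.2)
    intro x hx
    obtain ⟨h1, h2, u, hu, v, hv, w, hw, rfl⟩ := hS x hx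
    refine ⟨(u, v, w), ?_, rfl⟩
    rw [hT, Finset.mem_coe, Finset.mem_filter]
    simp only [mem_product]
    exact ⟨⟨hu, hv, hw⟩, h1, h2⟩
  have h2 : (T.card : ℝ) ≤ ∑ t ∈ T, K * (hh t.1 * hh t.2.1 * hh t.2.2) := by
    rw [Finset.card_eq_sum_ones]; push_cast
    refine Finset.sum_le_sum fun t ht => ?_
    simp only [hT, hW, mem_filter, mem_product, mem_Icc] at ht
    rw [← hh_mul (by omega) (by omega), ← hh_mul (Nat.mul_ne_zero (by omega) (by omega)) (by omega)]
    calc (1:ℝ) = 2 ^ (ArithmeticFunction.cardFactors (t.1 * t.2.1 * t.2.2)) * hh (t.1 * t.2.1 * t.2.2) := by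
          unfold hh; rw [← mul_pow]; norm_num
      _ ≤ _ := mul_le_mul_of_nonneg_right ht.2.2 (hh_pos _).le
  have h3 : ∑ t ∈ T, K * (hh t.1 * hh t.2.1 * hh t.2.2) ≤
      ∑ u ∈ W, ∑ v ∈ W, K * (hh u * hh v) * ∑ w ∈ W with u * v * w ≤ n, hh w := by
    simp_rw [Finset.mul_sum]
    have : ∀ u v, ∑ w ∈ W with u * v * w ≤ n, K * (hh u * hh v) * hh w =
        ∑ w ∈ W, if u * v * w ≤ n then K * (hh u * hh v) * hh w else 0 := by
      intro u v; rw [Finset.sum_filter]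
    simp_rw [this]
    rw [hT, Finset.sum_filter, Finset.sum_product]
    refine Finset.sum_le_sum fun u _ => ?_
    rw [Finset.sum_product]
    refine Finset.sum_le_sum fun v _ => Finset.sum_le_sum fun w _ => ?_
    have h0 : 0 ≤ K * (hh u * hh v) * hh w := by
      have := hh_pos u; have := hh_pos v; have := hh_pos w; positivity
    have : K * (hh u * hh v * hh w) = K * (hh u * hh v) * hh w := by ring
    simp only [this]
    split_ifs with h1 h2 h2
    · exact le_rfl
    · exact absurd h1.1 h2
    · exact h0
    · exact le_rfl
  have h4 : ∀ u ∈ W, ∀ v ∈ W, ∑ w ∈ W with u * v * w ≤ n, hh w ≤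
      n / (u * v) * (16 / Real.sqrt (Real.log a)) := by
    intro u hu v hv
    simp only [hW, mem_Icc] at hu hv
    have huv : 0 < u * v := Nat.mul_pos (by omega) (by omega)
    by_cases hc : a ≤ n / (u * v)
    · have h5 := L3 (n / (u*v)) (by omega)
      have h6 : ∑ w ∈ W with u * v * w ≤ n, hh w ≤ ∑ w ∈ Ioc 0 (n / (u*v)), hh w := by
        refine Finset.sum_le_sum_of_subset_of_nonneg ?_ fun u _ _ => (hh_pos u).le
        intro w hw
        simp only [hW, mem_filter, mem_Icc] at hw
        rw [mem_Ioc, Nat.le_div_iff_mul_le huv, mul_comm w]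
        exact ⟨by omega, hw.2⟩
      refine h6.trans (h5.trans ?_)
      have h7 : Real.sqrt (Real.log a) ≤ Real.sqrt (Real.log ((n / (u*v) : ℕ) : ℝ)) := by
        apply Real.sqrt_le_sqrt
        apply Real.log_le_log (by positivity)
        exact_mod_cast hc
      have h8 : ((n / (u*v) : ℕ) : ℝ) ≤ n / (u * v) := by
        have := @Nat.cast_div_le ℝ _ _ _ n (u*v)
        push_cast at this
        exact this
      calc _ ≤ 16 * ((n:ℝ) / (u * v)) / Real.sqrt (Real.log a) := by gcongr
        _ = _ := by ring
    · have : (W.filter fun w => u * v * w ≤ n) = ∅ := by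
        rw [Finset.filter_eq_empty_iff]
        intro w hw hle
        simp only [hW, mem_Icc] at hw
        apply hc
        rw [Nat.le_div_iff_mul_le huv, mul_comm]
        exact le_trans (Nat.mul_le_mul_left _ hw.1) hle
      rw [this, Finset.sum_empty]
      positivity
  calc (S.card : ℝ) ≤ T.card := by exact_mod_cast h1
    _ ≤ ∑ u ∈ W, ∑ v ∈ W, K * (hh u * hh v) * ∑ w ∈ W with u * v * w ≤ n, hh w := h2.trans h3
    _ ≤ ∑ u ∈ W, ∑ v ∈ W, K * (hh u * hh v) * (n / (u * v) * (16 / Real.sqrt (Real.log a))) := by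
        refine Finset.sum_le_sum fun u hu => Finset.sum_le_sum fun v hv => ?_
        have := hh_pos u; have := hh_pos v
        exact mul_le_mul_of_nonneg_left (h4 u hu v hv) (by positivity)
    _ = _ := by
        rw [sq, Finset.sum_mul_sum, Finset.mul_sum]
        refine Finset.sum_congr rfl fun u _ => ?_
        rw [Finset.mul_sum]
        refine Finset.sum_congr rfl fun v _ => ?_
        ring

lemma tau_sum (N : ℕ) : (∑ a ∈ Ioc 0 N, (a.divisors.card : ℝ)) ≤ N * (1 + Real.log N) := by
  have h := ArithmeticFunction.sum_Ioc_sigma0_eq_sum_div N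
  simp only [ArithmeticFunction.sigma_zero_apply] at h
  have h' : (∑ a ∈ Ioc 0 N, (a.divisors.card : ℝ)) = ∑ a ∈ Ioc 0 N, ((N / a : ℕ) : ℝ) := by
    exact_mod_cast h
  rw [h']
  calc _ ≤ ∑ a ∈ Ioc 0 N, (N:ℝ) * (a:ℝ)⁻¹ := by
        refine Finset.sum_le_sum fun a _ => ?_
        rw [← div_eq_mul_inv]; exact Nat.cast_div_le
    _ ≤ _ := by rw [← Finset.mul_sum]; gcongr; exact harm_le N

lemma L6 (n M : ℕ) (K : ℝ) (hK : 0 < K) (S : Finset ℕ)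
    (hS : ∀ x ∈ S, 0 < x ∧ x ≤ n ∧ K < (2:ℝ) ^ (ArithmeticFunction.cardFactors x)) :
    (S.card : ℝ) ≤ 2 * n / (M + 1) + M * (n * (1 + Real.log n) / K) := by
  classical
  set P := (Ioo M (n+1)).biUnion (fun q => (Ioc 0 (n / q^2)).image (fun a => q^2 * a)) with hP
  set R := (Ioc 0 M).biUnion (fun q => ((Ioc 0 (n / q^2)).filter
    (fun a => K < (q:ℝ)^2 * a.divisors.card)).image (fun a => q^2 * a)) with hR
  have h1 : S ⊆ P ∪ R := by
    intro x hx
    obtain ⟨hx0, hxn, hxK⟩ := hS x hx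
    obtain ⟨a, q, ha, hq, rfl, hsq⟩ := Nat.sq_mul_squarefree_of_pos hx0
    have hqn : a ≤ n / q^2 := by
      rw [Nat.le_div_iff_mul_le (by positivity), mul_comm]; exact hxn
    rw [mem_union]
    by_cases hqM : M < q
    · left
      rw [hP, mem_biUnion]
      refine ⟨q, ?_, ?_⟩
      · rw [mem_Ioo]
        refine ⟨hqM, ?_⟩
        nlinarith
      · exact mem_image.2 ⟨a, by rw [mem_Ioc]; exact ⟨ha, hqn⟩, rfl⟩
    · right
      rw [hR, mem_biUnion]
      refine ⟨q, by rw [mem_Ioc]; omega, ?_⟩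
      refine mem_image.2 ⟨a, ?_, rfl⟩
      rw [mem_filter, mem_Ioc]
      refine ⟨⟨ha, hqn⟩, hxK.trans_le ?_⟩
      have h2 := two_pow_le q hq.ne'
      have h3 := sqf_le a hsq
      rw [ArithmeticFunction.cardFactors_mul (by positivity) (by omega), sq,
        ArithmeticFunction.cardFactors_mul (by positivity) (by omega), pow_add, pow_add, ← sq]
      have h2' : (2:ℝ) ^ (ArithmeticFunction.cardFactors q) ≤ q := by exact_mod_cast h2
      have h3' : (2:ℝ) ^ (ArithmeticFunction.cardFactors a) = a.divisors.card := by exact_mod_cast h3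
      rw [h3']
      gcongr
  have hPc : (P.card : ℝ) ≤ 2 * n / (M + 1) := by
    have h2 : (P.card : ℝ) ≤ ∑ q ∈ Ioo M (n+1), (n:ℝ) * ((q:ℝ)^2)⁻¹ := by
      calc (P.card : ℝ) ≤ ∑ q ∈ Ioo M (n+1), ((((Ioc 0 (n / q^2)).image (fun a => q^2 * a)).card : ℕ) : ℝ) := by
            exact_mod_cast Finset.card_biUnion_le
        _ ≤ _ := by
            refine Finset.sum_le_sum fun q _ => ?_
            have h3 : (((Ioc 0 (n / q^2)).image (fun a => q^2 * a)).card : ℝ) ≤ ((n / q^2 : ℕ) : ℝ) := by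
              have := Finset.card_image_le (s := Ioc 0 (n / q^2)) (f := fun a => q^2 * a)
              rw [Nat.card_Ioc, Nat.sub_zero] at this
              exact_mod_cast this
            refine h3.trans ?_
            rw [← div_eq_mul_inv]
            exact_mod_cast @Nat.cast_div_le ℝ _ _ _ n (q^2)
    rw [← Finset.mul_sum] at h2
    refine h2.trans ?_
    have := @sum_Ioo_inv_sq_le ℝ _ _ _ M (n+1)
    calc _ ≤ (n:ℝ) * (2 / (M+1)) := by gcongr
      _ = _ := by ring
  have hRc : (R.card : ℝ) ≤ M * (n * (1 + Real.log n) / K) := by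
    calc (R.card : ℝ) ≤ ∑ q ∈ Ioc 0 M, (((((Ioc 0 (n / q^2)).filter
            (fun a => K < (q:ℝ)^2 * a.divisors.card)).image (fun a => q^2 * a)).card : ℕ) : ℝ) := by
            rw [← Nat.cast_sum]; exact Nat.cast_le.2 (by rw [hR]; exact Finset.card_biUnion_le)
      _ ≤ ∑ q ∈ Ioc 0 M, (n * (1 + Real.log n) / K) := by
            refine Finset.sum_le_sum fun q hq => ?_
            simp only [mem_Ioc] at hq
            have hq0 : (0:ℝ) < q := by exact_mod_cast hq.1
            have h3 : (((((Ioc 0 (n / q^2)).filter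
              (fun a => K < (q:ℝ)^2 * a.divisors.card)).image (fun a => q^2 * a)).card : ℕ) : ℝ) ≤
              ((((Ioc 0 (n / q^2)).filter (fun a => K < (q:ℝ)^2 * a.divisors.card)).card : ℕ) : ℝ) := by
              exact_mod_cast Finset.card_image_le
            refine h3.trans ?_
            rw [le_div_iff₀ hK, ← nsmul_eq_mul, ← Finset.sum_const]
            calc _ ≤ ∑ a ∈ Ioc 0 (n / q^2) with K < (q:ℝ)^2 * a.divisors.card, (q:ℝ)^2 * a.divisors.card := by
                  refine Finset.sum_le_sum fun a ha => ?_
                  exact (mem_filter.1 ha).2.le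
              _ ≤ ∑ a ∈ Ioc 0 (n / q^2), (q:ℝ)^2 * a.divisors.card := by
                  refine Finset.sum_le_sum_of_subset_of_nonneg (Finset.filter_subset _ _) fun _ _ _ => by positivity
              _ ≤ (q:ℝ)^2 * (((n / q^2 : ℕ) : ℝ) * (1 + Real.log ((n / q^2 : ℕ) : ℝ))) := by
                  rw [← Finset.mul_sum]; gcongr; exact tau_sum _
              _ ≤ (q:ℝ)^2 * (((n:ℝ) / q^2) * (1 + Real.log n)) := by
                  have h4 : ((n / q^2 : ℕ) : ℝ) ≤ (n:ℝ) / q^2 := by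
                    exact_mod_cast @Nat.cast_div_le ℝ _ _ _ n (q^2)
                  have h5 : Real.log ((n / q^2 : ℕ) : ℝ) ≤ Real.log n := by
                    rcases Nat.eq_zero_or_pos (n / q^2) with h | h
                    · rw [h]; simp; exact Real.log_natCast_nonneg n
                    · exact Real.log_le_log (by exact_mod_cast h) (by exact_mod_cast Nat.div_le_self _ _)
                  have h6 := Real.log_natCast_nonneg (n / q^2)
                  gcongr
              _ = _ := by field_simp
      _ = _ := by rw [Finset.sum_const, Nat.card_Ioc, nsmul_eq_mul]; simp
  calc (S.card : ℝ) ≤ ((P ∪ R).card : ℝ) := by exact_mod_cast Finset.card_le_card h1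
    _ ≤ P.card + R.card := by exact_mod_cast Finset.card_union_le _ _
    _ ≤ _ := add_le_add hPc hRc

lemma num_const : 1 - Real.exp 1 * Real.log 3 / (2 * Real.sqrt 3) < 1/6 - 1/100 := by
  have he := Real.exp_one_gt_d9
  have he2 := Real.exp_one_lt_d9
  have h3 : (27/25 : ℝ) < Real.log 3 := by
    have : (27:ℝ) < 25 * Real.log 3 := by
      rw [show 25 * Real.log 3 = Real.log (3 ^ 25) by rw [Real.log_pow]; norm_num,
        Real.lt_log_iff_exp_lt (by norm_num), show (27:ℝ) = (27:ℕ) * 1 by norm_num, Real.exp_nat_mul]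
      calc Real.exp 1 ^ 27 < 2.7182818286 ^ 27 := by gcongr
        _ < 3 ^ 25 := by norm_num
    linarith
  have hs : Real.sqrt 3 < 1.7321 := by
    rw [Real.sqrt_lt' (by norm_num)]; norm_num
  have hs0 : 0 < Real.sqrt 3 := Real.sqrt_pos.2 (by norm_num)
  have : (0.845 : ℝ) < Real.exp 1 * Real.log 3 / (2 * Real.sqrt 3) := by
    rw [lt_div_iff₀ (by positivity)]
    have : 2.7182 * (27/25) ≤ Real.exp 1 * Real.log 3 := by gcongr; linarith
    linarith
  linarith

lemma I_bound (A B l : ℝ) (a b : ℕ) (hA : 0 < A) (hB : 1 ≤ B) (hl : 1 ≤ l)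
    (ha : A ≤ a) (hb : (b:ℝ) ≤ B) (hAB : Real.log B - Real.log A ≤ 32 * Real.log l) :
    ((Nat.log 2 b + 1 - Nat.log 2 a : ℕ) : ℝ) ≤ 50 * Real.log l + 2 := by
  have hll : 0 ≤ Real.log l := Real.log_nonneg hl
  have hl2 := Real.log_two_gt_d9
  rcases le_total (Nat.log 2 b + 1) (Nat.log 2 a) with h | h
  · rw [Nat.sub_eq_zero_of_le h]; push_cast; linarith
  rw [Nat.cast_sub h]; push_cast
  have h1 : (Nat.log 2 b : ℝ) * Real.log 2 ≤ Real.log B := by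
    rcases Nat.eq_zero_or_pos b with rfl | hb0
    · simp; exact Real.log_nonneg hB
    · rw [← Real.log_pow]
      apply Real.log_le_log (by positivity)
      refine le_trans ?_ hb
      exact_mod_cast Nat.pow_log_le_self 2 hb0.ne'
  have h2 : Real.log A ≤ (Nat.log 2 a + 1 : ℝ) * Real.log 2 := by
    have : (Nat.log 2 a + 1 : ℝ) * Real.log 2 = Real.log (2 ^ (Nat.log 2 a + 1)) := by
      rw [Real.log_pow]; push_cast; ring
    rw [this]
    apply Real.log_le_log hA
    refine ha.trans ?_
    exact_mod_cast (Nat.lt_pow_succ_log_self (by norm_num) a).le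
  have h3 : ((Nat.log 2 b : ℝ) - Nat.log 2 a - 1) * Real.log 2 ≤ 32 * Real.log l := by nlinarith
  by_contra hcon
  push Not at hcon
  have : 50 * Real.log l ≤ ((Nat.log 2 b : ℝ) - Nat.log 2 a - 1) := by linarith
  have h4 : (50 * Real.log l + 0) * Real.log 2 < ((Nat.log 2 b : ℝ) - Nat.log 2 a - 1) * Real.log 2 := by
    gcongr; linarith
  nlinarith

lemma evs : ∀ᶠ n : ℕ in atTop, 1 ≤ Real.log n ∧ (2:ℝ) ≤ (n:ℝ) ^ ((1:ℝ)/6) ∧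
    (Real.log n) ^ 16 ≤ (n:ℝ) ^ ((1:ℝ)/6) ∧
    50 * Real.log (Real.log n) + 2 ≤ (Real.log n) ^ ((1:ℝ)/200) := by
  have hn : Tendsto (fun n : ℕ => (n:ℝ)) atTop atTop := tendsto_natCast_atTop_atTop
  have hl : Tendsto (fun n : ℕ => Real.log n) atTop atTop := Real.tendsto_log_atTop.comp hn
  have h1 := hl.eventually_ge_atTop 1
  have h2 := ((tendsto_rpow_atTop (y := (1:ℝ)/6) (by norm_num)).comp hn).eventually_ge_atTop 2
  have h3 := hn.eventually ((isLittleO_log_rpow_rpow_atTop (s := (1:ℝ)/6) 16 (by norm_num)).bound (c := 1) (by norm_num))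
  have h4 := hl.eventually ((isLittleO_log_rpow_atTop (r := (1:ℝ)/200) (by norm_num)).bound (c := 1/100) (by norm_num))
  have h5 := ((tendsto_rpow_atTop (y := (1:ℝ)/200) (by norm_num)).comp hl).eventually_ge_atTop 4
  filter_upwards [h1, h2, h3, h4, h5] with n h1 h2 h3 h4 h5
  refine ⟨h1, h2, ?_, ?_⟩
  · rw [Real.norm_of_nonneg (by positivity), Real.norm_of_nonneg (by positivity), one_mul] at h3
    exact_mod_cast h3
  · rw [Real.norm_of_nonneg (Real.log_nonneg h1), Real.norm_of_nonneg (by positivity)] at h4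
    simp only [Function.comp] at h5
    linarith

theorem stmt_19 (ε : ℝ) (hε : 0 < ε) : ∃ n0 : ℕ, ∀ n : ℕ, n0 ≤ n →
    ({b : ℕ | b ∈ Finset.Icc 1 n ∧ ∃ u v w : ℕ,
        0 < u ∧ 0 < v ∧ 0 < w ∧
        (n : ℝ) ^ ((1 : ℝ)/3) / (Real.log n) ^ 16 ≤ (u : ℝ) ∧
        (u : ℝ) ≤ (n : ℝ) ^ ((1 : ℝ)/3) * (Real.log n) ^ 16 ∧
        (n : ℝ) ^ ((1 : ℝ)/3) / (Real.log n) ^ 16 ≤ (v : ℝ) ∧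
        (v : ℝ) ≤ (n : ℝ) ^ ((1 : ℝ)/3) * (Real.log n) ^ 16 ∧
        (n : ℝ) ^ ((1 : ℝ)/3) / (Real.log n) ^ 16 ≤ (w : ℝ) ∧
        (w : ℝ) ≤ (n : ℝ) ^ ((1 : ℝ)/3) * (Real.log n) ^ 16 ∧
        b = u * v * w}.ncard : ℝ)
      ≤ (n : ℝ) / (Real.log n) ^ (1 - Real.exp 1 * Real.log 3 / (2 * Real.sqrt 3) - ε) := by
  classical
  have hl : Tendsto (fun n : ℕ => Real.log n) atTop atTop :=
    Real.tendsto_log_atTop.comp tendsto_natCast_atTop_atTop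
  have hd := num_const
  set d := 1 - Real.exp 1 * Real.log 3 / (2 * Real.sqrt 3) with hdd
  have h5 := ((tendsto_rpow_atTop (y := 1/6 - 1/100 - d + ε) (by linarith)).comp hl).eventually_ge_atTop 442372
  obtain ⟨n0, hn0⟩ := eventually_atTop.1 (evs.and h5)
  refine ⟨n0, fun n hn => ?_⟩
  obtain ⟨⟨e1, e2, e3, e4⟩, e5⟩ := hn0 n hn
  simp only [Function.comp] at e5
  set l := Real.log n with hldef
  have l0 : 0 < l := by linarith
  have hn1 : (0:ℝ) < n := by
    rcases Nat.eq_zero_or_pos n with h | h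
    · rw [hldef, h] at e1; simp at e1; linarith
    · exact_mod_cast h
  set A := (n : ℝ) ^ ((1 : ℝ)/3) / l ^ 16 with hA
  set B := (n : ℝ) ^ ((1 : ℝ)/3) * l ^ 16 with hB
  have h13 : (n : ℝ) ^ ((1 : ℝ)/3) = (n : ℝ) ^ ((1 : ℝ)/6) * (n : ℝ) ^ ((1 : ℝ)/6) := by
    rw [← Real.rpow_add hn1]; norm_num
  have hA1 : (n : ℝ) ^ ((1 : ℝ)/6) ≤ A := by
    rw [hA, le_div_iff₀ (by positivity), h13]; gcongr
  have hA0 : 0 < A := by linarith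
  have hB1 : 1 ≤ B := by
    have : 1 ≤ l ^ 16 := one_le_pow₀ e1
    rw [hB, h13]; nlinarith
  have hAB : Real.log B - Real.log A ≤ 32 * Real.log l := by
    rw [hA, hB, Real.log_mul (by positivity) (by positivity), Real.log_div (by positivity) (by positivity),
      Real.log_pow]
    push_cast; linarith
  set a := ⌈A⌉₊ with ha
  set b := ⌊B⌋₊ with hb
  have haA : A ≤ a := Nat.le_ceil A
  have hbB : (b:ℝ) ≤ B := Nat.floor_le (by linarith)
  have ha2 : 2 ≤ a := by
    have : (2:ℝ) ≤ a := by linarith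
    exact_mod_cast this
  have hI := (I_bound A B l a b hA0 hB1 e1 haA hbB hAB).trans e4
  have hla : l / 6 ≤ Real.log a := by
    have : Real.log ((n : ℝ) ^ ((1 : ℝ)/6)) ≤ Real.log a := Real.log_le_log (by positivity) (by linarith)
    rw [Real.log_rpow hn1] at this
    linarith
  have hsq : l ^ ((1:ℝ)/2) / 3 ≤ Real.sqrt (Real.log a) := by
    apply Real.le_sqrt_of_sq_le
    rw [div_pow, ← Real.rpow_natCast, ← Real.rpow_mul l0.le]
    norm_num
    linarith
  set X := {b : ℕ | b ∈ Finset.Icc 1 n ∧ ∃ u v w : ℕ,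
        0 < u ∧ 0 < v ∧ 0 < w ∧ A ≤ (u : ℝ) ∧ (u : ℝ) ≤ B ∧ A ≤ (v : ℝ) ∧
        (v : ℝ) ≤ B ∧ A ≤ (w : ℝ) ∧ (w : ℝ) ≤ B ∧ b = u * v * w} with hX
  have hfin : X.Finite := (Finset.finite_toSet (Finset.Icc 1 n)).subset fun x hx => hx.1
  rw [Set.ncard_eq_toFinset_card X hfin]
  set F := hfin.toFinset with hF
  set K := l ^ ((4:ℝ)/3) with hK
  have hK0 : 0 < K := by positivity
  rw [← Finset.card_filter_add_card_filter_not
    (fun x : ℕ => (2:ℝ) ^ (ArithmeticFunction.cardFactors x) ≤ K)]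
  have c1 := L5 n a b ha2 K hK0.le (F.filter fun x : ℕ => (2:ℝ) ^ (ArithmeticFunction.cardFactors x) ≤ K) (by
    intro x hx
    rw [mem_filter, hF, Set.Finite.mem_toFinset] at hx
    obtain ⟨⟨hx1, u, v, w, hu0, hv0, hw0, hu, hu', hv, hv', hw, hw', hxe⟩, hx2⟩ := hx
    refine ⟨(mem_Icc.1 hx1).2, hx2, u, ?_, v, ?_, w, ?_, hxe⟩ <;> rw [mem_Icc]
    · exact ⟨Nat.ceil_le.2 hu, Nat.le_floor hu'⟩
    · exact ⟨Nat.ceil_le.2 hv, Nat.le_floor hv'⟩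
    · exact ⟨Nat.ceil_le.2 hw, Nat.le_floor hw'⟩)
  have c2 := L6 n ⌊l ^ ((1:ℝ)/6)⌋₊ K hK0 (F.filter fun x : ℕ => ¬ (2:ℝ) ^ (ArithmeticFunction.cardFactors x) ≤ K) (by
    intro x hx
    rw [mem_filter, hF, Set.Finite.mem_toFinset] at hx
    have := mem_Icc.1 hx.1.1
    exact ⟨by omega, this.2, not_le.1 hx.2⟩)
  have c3 := L4 a b ha2
  have hW0 : 0 ≤ ∑ u ∈ Icc a b, hh u / u := Finset.sum_nonneg fun m _ => div_nonneg (hh_pos m).le (by positivity)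
  have hpos : 0 < l ^ ((1:ℝ)/2) := by positivity
  have hinv : ∀ c : ℝ, 0 ≤ c → c / Real.sqrt (Real.log a) ≤ 3 * c * l ^ (-(1:ℝ)/2) := by
    intro c hc
    calc _ ≤ c / (l ^ ((1:ℝ)/2) / 3) := by gcongr
      _ = _ := by
        rw [show -(1:ℝ)/2 = -(1/2) by ring, Real.rpow_neg l0.le]; field_simp
  have c4 : ∑ u ∈ Icc a b, hh u / u ≤ l ^ ((1:ℝ)/200) * (96 * l ^ (-(1:ℝ)/2)) := by
    refine c3.trans ?_
    have := hinv 32 (by norm_num)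
    gcongr
    linarith
  have c5 : K * n * (16 / Real.sqrt (Real.log a)) * (∑ u ∈ Icc a b, hh u / u) ^ 2 ≤
      442368 * (n * l ^ (-(1/6 - 1/100 : ℝ))) := by
    calc _ ≤ K * n * (3 * 16 * l ^ (-(1:ℝ)/2)) * (l ^ ((1:ℝ)/200) * (96 * l ^ (-(1:ℝ)/2))) ^ 2 := by
          have := hinv 16 (by norm_num)
          gcongr
      _ = 442368 * (n * (l ^ ((4:ℝ)/3) * l ^ (-(1:ℝ)/2) * (l ^ ((1:ℝ)/200) * l ^ ((1:ℝ)/200)) * (l ^ (-(1:ℝ)/2) * l ^ (-(1:ℝ)/2)))) := by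
          rw [hK]; ring
      _ = _ := by
          simp only [← Real.rpow_add l0]; norm_num
  have hm : l ^ (-(1:ℝ)/6) ≤ l ^ (-(1/6 - 1/100 : ℝ)) := Real.rpow_le_rpow_of_exponent_le e1 (by norm_num)
  have c6 : 2 * n / ((⌊l ^ ((1:ℝ)/6)⌋₊ : ℝ) + 1) + ⌊l ^ ((1:ℝ)/6)⌋₊ * (n * (1 + l) / K) ≤
      4 * (n * l ^ (-(1/6 - 1/100 : ℝ))) := by
    have f1 : (⌊l ^ ((1:ℝ)/6)⌋₊ : ℝ) ≤ l ^ ((1:ℝ)/6) := Nat.floor_le (by positivity)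
    have f2 : l ^ ((1:ℝ)/6) ≤ (⌊l ^ ((1:ℝ)/6)⌋₊ : ℝ) + 1 := (Nat.lt_floor_add_one _).le
    have f3 : 0 < l ^ ((1:ℝ)/6) := by positivity
    have g1 : 2 * n / ((⌊l ^ ((1:ℝ)/6)⌋₊ : ℝ) + 1) ≤ 2 * (n * l ^ (-(1:ℝ)/6)) := by
      calc _ ≤ 2 * n / l ^ ((1:ℝ)/6) := by gcongr
        _ = _ := by
          rw [show -(1:ℝ)/6 = -(1/6) by ring, Real.rpow_neg l0.le]; ring
    have g2 : ⌊l ^ ((1:ℝ)/6)⌋₊ * (n * (1 + l) / K) ≤ 2 * (n * l ^ (-(1:ℝ)/6)) := by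
      calc _ ≤ l ^ ((1:ℝ)/6) * (n * (l + l) / K) := by gcongr
        _ = 2 * (n * (l ^ ((1:ℝ)/6) * l ^ (1:ℝ) * l ^ (-((4:ℝ)/3)))) := by
          rw [Real.rpow_neg l0.le, Real.rpow_one, hK]; ring
        _ = _ := by simp only [← Real.rpow_add l0]; norm_num
    have : n * l ^ (-(1:ℝ)/6) ≤ n * l ^ (-(1/6 - 1/100 : ℝ)) := by gcongr
    linarith
  have tot : (442372 : ℝ) * (n * l ^ (-(1/6 - 1/100 : ℝ))) ≤ n / l ^ (d - ε) := by
    calc _ ≤ l ^ (1/6 - 1/100 - d + ε) * (n * l ^ (-(1/6 - 1/100 : ℝ))) := by gcongr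
      _ = n * (l ^ (1/6 - 1/100 - d + ε) * l ^ (-(1/6 - 1/100 : ℝ))) := by ring
      _ = _ := by
        rw [← Real.rpow_add l0, div_eq_mul_inv (n:ℝ) (l ^ (d - ε)), ← Real.rpow_neg l0.le]
        congr 2; ring
  push_cast
  linarith
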